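/- Let β ∈ (−1, 1), μ₊, μ₋ ∈ ℝ, q > 0 and y < 0. Then ∫₀^∞ e^{−q t} · [ 2(1−β) e^{2 μ₋ y} ∫₀^∞ ∫₀^t h(t − τ; (1+β) b, μ₊) · h(τ; (1−β) b − y, −μ₋) dτ db ] dt = (2(1−β)/D(q)) · e^{(μ₋ + √(2q + μ₋²)) y}. -/

import Mathlib

open MeasureTheory Real Set Filter

/-- The auxiliary density `h(t; x, μ) = |x| / √(2π t³) · exp(−(x + μ t)² / (2t))`. -/
noncomputable def h (t x μ : ℝ) : ℝ :=
  |x| / Real.sqrt (2 * Real.pi * t ^ 3) * Real.exp (-(x + μ * t) ^ 2 / (2 * t))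

/-- `D(q) = (1+β)(μ₊ + √(2q+μ₊²)) + (1−β)(−μ₋ + √(2q+μ₋²))`. -/
noncomputable def D (β μp μm q : ℝ) : ℝ :=
  (1 + β) * (μp + Real.sqrt (2 * q + μp ^ 2)) + (1 - β) * (-μm + Real.sqrt (2 * q + μm ^ 2))

/-- The centred primitive `z ↦ ∫₀ᶻ exp (-u² / 2) du` of the Gaussian kernel. -/
noncomputable def gaussianPrimitive (z : ℝ) : ℝ :=
  ∫ u in (0 : ℝ)..z, Real.exp (-(1 / 2) * u ^ 2)

theorem hasDerivAt_gaussianPrimitive (z : ℝ) :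
    HasDerivAt gaussianPrimitive (Real.exp (-(1 / 2) * z ^ 2)) z :=
  (by fun_prop : Continuous fun u : ℝ => Real.exp (-(1 / 2) * u ^ 2)).integral_hasStrictDerivAt 0 z
    |>.hasDerivAt

theorem gaussianPrimitive_neg (z : ℝ) : gaussianPrimitive (-z) = -gaussianPrimitive z := by
  have key := intervalIntegral.integral_comp_neg (a := 0) (b := z)
    (fun u : ℝ => Real.exp (-(1 / 2) * u ^ 2))
  simp only [even_two.neg_pow, neg_zero] at key
  rw [gaussianPrimitive, gaussianPrimitive, key, intervalIntegral.integral_symm]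

theorem tendsto_gaussianPrimitive_atTop :
    Tendsto gaussianPrimitive atTop (nhds (Real.sqrt (2 * Real.pi) / 2)) := by
  have key := intervalIntegral_tendsto_integral_Ioi (μ := volume) 0
    ((integrable_exp_neg_mul_sq (b := 1 / 2) (by norm_num)).integrableOn) tendsto_id
  rw [integral_gaussian_Ioi, show Real.pi / (1 / 2) = 2 * Real.pi by ring] at key
  exact key

theorem tendsto_gaussianPrimitive_atBot :
    Tendsto gaussianPrimitive atBot (nhds (-(Real.sqrt (2 * Real.pi) / 2))) := by
  have key := (tendsto_gaussianPrimitive_atTop.comp tendsto_neg_atBot_atTop).neg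
  refine key.congr fun z => ?_
  simp [gaussianPrimitive_neg]

/-- An antiderivative of the (unnormalised) inverse Gaussian density. -/
noncomputable def inverseGaussianPrimitive (a x t : ℝ) : ℝ :=
  gaussianPrimitive (a * Real.sqrt t - x / Real.sqrt t) +
    Real.exp (2 * a * x) * gaussianPrimitive (-a * Real.sqrt t - x / Real.sqrt t)

theorem hasDerivAt_inverseGaussianPrimitive (a x : ℝ) {t : ℝ} (ht : 0 < t) :
    HasDerivAt (inverseGaussianPrimitive a x)
      (x / Real.sqrt (t ^ 3) * Real.exp (-(x - a * t) ^ 2 / (2 * t))) t := by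
  have hs : 0 < Real.sqrt t := Real.sqrt_pos.2 ht
  have hsq : Real.sqrt t ^ 2 = t := Real.sq_sqrt ht.le
  have hcube : Real.sqrt (t ^ 3) = t * Real.sqrt t := by
    rw [pow_succ, Real.sqrt_mul (by positivity), Real.sqrt_sq ht.le]
  have hd := Real.hasDerivAt_sqrt ht.ne'
  have harg (c : ℝ) := (hd.const_mul c).sub ((hasDerivAt_const t x).div hd hs.ne')
  have key := ((hasDerivAt_gaussianPrimitive _).comp t (harg a)).add
    (((hasDerivAt_gaussianPrimitive _).comp t (harg (-a))).const_mul (Real.exp (2 * a * x)))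
  refine key.congr_deriv ?_
  have e₁ : Real.exp (-(1 / 2) * (a * Real.sqrt t - x / Real.sqrt t) ^ 2) =
      Real.exp (-(x - a * t) ^ 2 / (2 * t)) := by
    congr 1
    generalize Real.sqrt t = s at hs hsq ⊢
    subst hsq
    field_simp
    ring
  have e₂ : Real.exp (2 * a * x) * Real.exp (-(1 / 2) * (-a * Real.sqrt t - x / Real.sqrt t) ^ 2) =
      Real.exp (-(x - a * t) ^ 2 / (2 * t)) := by
    rw [← Real.exp_add]
    congr 1
    generalize Real.sqrt t = s at hs hsq ⊢
    subst hsq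
    field_simp
    ring
  simp only [Pi.sub_apply, Pi.div_apply]
  rw [e₁, ← mul_assoc, e₂, hcube, hsq]
  generalize Real.exp (-(x - a * t) ^ 2 / (2 * t)) = e
  field_simp
  ring

theorem tendsto_inverseGaussianPrimitive_atTop {a : ℝ} (ha : 0 < a) (x : ℝ) :
    Tendsto (inverseGaussianPrimitive a x) atTop
      (nhds (Real.sqrt (2 * Real.pi) / 2 +
        Real.exp (2 * a * x) * -(Real.sqrt (2 * Real.pi) / 2))) := by
  have hdiv : Tendsto (fun t => -(x / Real.sqrt t)) atTop (nhds (-0)) :=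
    (tendsto_sqrt_atTop.const_div_atTop x).neg
  refine (tendsto_gaussianPrimitive_atTop.comp ?_).add
    ((tendsto_gaussianPrimitive_atBot.comp ?_).const_mul _)
  · exact (tendsto_sqrt_atTop.const_mul_atTop ha).atTop_add hdiv
  · exact (tendsto_sqrt_atTop.const_mul_atTop_of_neg (neg_neg_of_pos ha)).atBot_add hdiv

theorem tendsto_inverseGaussianPrimitive_zero (a : ℝ) {x : ℝ} (hx : 0 < x) :
    Tendsto (inverseGaussianPrimitive a x) (nhdsWithin 0 (Ioi 0))
      (nhds (-(Real.sqrt (2 * Real.pi) / 2) +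
        Real.exp (2 * a * x) * -(Real.sqrt (2 * Real.pi) / 2))) := by
  have hsqrt : Tendsto Real.sqrt (nhdsWithin 0 (Ioi 0)) (nhds 0) := by
    simpa using (Real.continuous_sqrt.tendsto 0).mono_left nhdsWithin_le_nhds
  have hsqrt' : Tendsto Real.sqrt (nhdsWithin 0 (Ioi 0)) (nhdsWithin 0 (Ioi 0)) :=
    tendsto_nhdsWithin_iff.2 ⟨hsqrt, by
      filter_upwards [self_mem_nhdsWithin] with t ht using Real.sqrt_pos.2 ht⟩
  have hdiv : Tendsto (fun t => -(x / Real.sqrt t)) (nhdsWithin 0 (Ioi 0)) atBot :=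
    tendsto_neg_atTop_atBot.comp
      ((tendsto_inv_nhdsGT_zero.comp hsqrt').const_mul_atTop hx)
  have harg (c : ℝ) : Tendsto (fun t => c * Real.sqrt t - x / Real.sqrt t)
      (nhdsWithin 0 (Ioi 0)) atBot :=
    (hsqrt.const_mul c).add_atBot hdiv
  exact (tendsto_gaussianPrimitive_atBot.comp (harg a)).add
    ((tendsto_gaussianPrimitive_atBot.comp (harg (-a))).const_mul _)

theorem integrableOn_and_integral_inverseGaussian {a x : ℝ} (ha : 0 < a) (hx : 0 < x) :
    IntegrableOn (fun t => x / Real.sqrt (t ^ 3) * Real.exp (-(x - a * t) ^ 2 / (2 * t)))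
        (Ioi 0) ∧
      ∫ t in Ioi (0 : ℝ), x / Real.sqrt (t ^ 3) * Real.exp (-(x - a * t) ^ 2 / (2 * t)) =
        Real.sqrt (2 * Real.pi) := by
  set F := Function.update (inverseGaussianPrimitive a x) 0 (-(Real.sqrt (2 * Real.pi) / 2) +
        Real.exp (2 * a * x) * -(Real.sqrt (2 * Real.pi) / 2)) with hF
  have heq {t : ℝ} (ht : 0 < t) : F =ᶠ[nhds t] inverseGaussianPrimitive a x := by
    filter_upwards [Ioi_mem_nhds ht] with s hs using Function.update_of_ne (ne_of_gt hs) _ _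
  have hcont : ContinuousWithinAt F (Ici 0) 0 := by
    rw [hF, continuousWithinAt_update_same, Ici_sdiff_left]
    exact tendsto_inverseGaussianPrimitive_zero a hx
  have hderiv (t : ℝ) (ht : t ∈ Ioi (0 : ℝ)) :
      HasDerivAt F (x / Real.sqrt (t ^ 3) * Real.exp (-(x - a * t) ^ 2 / (2 * t))) t :=
    (hasDerivAt_inverseGaussianPrimitive a x ht).congr_of_eventuallyEq (heq ht)
  have hpos (t : ℝ) (_ : t ∈ Ioi (0 : ℝ)) :
      0 ≤ x / Real.sqrt (t ^ 3) * Real.exp (-(x - a * t) ^ 2 / (2 * t)) := by positivity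
  have hlim := (tendsto_inverseGaussianPrimitive_atTop ha x).congr' (f₂ := F) (by
    filter_upwards [eventually_gt_atTop 0] with s hs
    exact (Function.update_of_ne (ne_of_gt hs) _ _).symm)
  refine ⟨integrableOn_Ioi_deriv_of_nonneg hcont hderiv hpos hlim, ?_⟩
  rw [integral_Ioi_of_hasDerivAt_of_nonneg hcont hderiv hpos hlim, hF, Function.update_self]
  ring

theorem h_nonneg (t x μ : ℝ) : 0 ≤ h t x μ := by
  unfold h
  positivity

theorem measurable_h (μ : ℝ) : Measurable fun p : ℝ × ℝ => h p.1 p.2 μ := by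
  unfold h
  fun_prop

theorem exp_mul_h_eq {q : ℝ} (hq : 0 < q) (μ : ℝ) {t x : ℝ} (ht : 0 < t) (hx : 0 < x) :
    Real.exp (-q * t) * h t x μ =
      Real.exp (-(μ + Real.sqrt (2 * q + μ ^ 2)) * x) / Real.sqrt (2 * Real.pi) *
        (x / Real.sqrt (t ^ 3) *
          Real.exp (-(x - Real.sqrt (2 * q + μ ^ 2) * t) ^ 2 / (2 * t))) := by
  have hsq : Real.sqrt (2 * q + μ ^ 2) ^ 2 = 2 * q + μ ^ 2 := Real.sq_sqrt (by positivity)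
  have hexp : Real.exp (-q * t) * Real.exp (-(x + μ * t) ^ 2 / (2 * t)) =
      Real.exp (-(μ + Real.sqrt (2 * q + μ ^ 2)) * x) *
        Real.exp (-(x - Real.sqrt (2 * q + μ ^ 2) * t) ^ 2 / (2 * t)) := by
    rw [← Real.exp_add, ← Real.exp_add]
    congr 1
    generalize Real.sqrt (2 * q + μ ^ 2) = s at hsq ⊢
    field_simp
    linear_combination t ^ 2 * hsq
  rw [h, abs_of_pos hx, Real.sqrt_mul (by positivity)]
  linear_combination x / (Real.sqrt (2 * Real.pi) * Real.sqrt (t ^ 3)) * hexp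

theorem integrableOn_and_integral_exp_mul_h {q : ℝ} (hq : 0 < q) (μ : ℝ) {x : ℝ} (hx : 0 < x) :
    IntegrableOn (fun t => Real.exp (-q * t) * h t x μ) (Ioi 0) ∧
      ∫ t in Ioi (0 : ℝ), Real.exp (-q * t) * h t x μ =
        Real.exp (-(μ + Real.sqrt (2 * q + μ ^ 2)) * x) := by
  obtain ⟨hint, hval⟩ := integrableOn_and_integral_inverseGaussian
    (a := Real.sqrt (2 * q + μ ^ 2)) (by positivity) hx
  have heq : EqOn (fun t => Real.exp (-q * t) * h t x μ) _ (Ioi 0) :=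
    fun t ht => exp_mul_h_eq hq μ ht hx
  refine ⟨(integrableOn_congr_fun heq measurableSet_Ioi).2 (hint.const_mul _), ?_⟩
  rw [setIntegral_congr_fun measurableSet_Ioi heq, integral_const_mul, hval]
  field_simp

/-- The time convolution `∫₀ᵗ h(t - τ; x, μ) h(τ; z, ν) dτ`. -/
noncomputable def hConv (x μ z ν t : ℝ) : ℝ :=
  ∫ τ in (0 : ℝ)..t, h (t - τ) x μ * h τ z ν

theorem exp_mul_hConv (q x μ z ν t : ℝ) :
    Real.exp (-q * t) * hConv x μ z ν t =
      ∫ τ in (0 : ℝ)..t, ContinuousLinearMap.mul ℝ ℝ (Real.exp (-q * τ) * h τ z ν)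
        (Real.exp (-q * (t - τ)) * h (t - τ) x μ) := by
  rw [hConv, ← intervalIntegral.integral_const_mul]
  congr 1 with τ
  rw [ContinuousLinearMap.mul_apply', show -q * t = -q * τ + -q * (t - τ) by ring, Real.exp_add]
  ring

theorem hConv_nonneg (x μ z ν : ℝ) {t : ℝ} (ht : 0 ≤ t) : 0 ≤ hConv x μ z ν t :=
  intervalIntegral.integral_nonneg ht fun _ _ => mul_nonneg (h_nonneg _ _ _) (h_nonneg _ _ _)

theorem integrableOn_and_integral_exp_mul_hConv {q : ℝ} (hq : 0 < q) (μ ν : ℝ) {x z : ℝ}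
    (hx : 0 < x) (hz : 0 < z) :
    IntegrableOn (fun t => Real.exp (-q * t) * hConv x μ z ν t) (Ioi 0) ∧
      ∫ t in Ioi (0 : ℝ), Real.exp (-q * t) * hConv x μ z ν t =
        Real.exp (-(ν + Real.sqrt (2 * q + ν ^ 2)) * z) *
          Real.exp (-(μ + Real.sqrt (2 * q + μ ^ 2)) * x) := by
  obtain ⟨hint₁, hval₁⟩ := integrableOn_and_integral_exp_mul_h hq ν hz
  obtain ⟨hint₂, hval₂⟩ := integrableOn_and_integral_exp_mul_h hq μ hx
  simp_rw [exp_mul_hConv]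
  constructor
  · rw [← integrable_indicator_iff measurableSet_Ioi]
    exact integrable_posConvolution hint₁ hint₂ (ContinuousLinearMap.mul ℝ ℝ)
  · rw [integral_posConvolution hint₁ hint₂, hval₁, hval₂, ContinuousLinearMap.mul_apply']

theorem aestronglyMeasurable_exp_mul_hConv (q μ ν : ℝ) {f g : ℝ → ℝ} (hf : Measurable f)
    (hg : Measurable g) :
    AEStronglyMeasurable (fun p : ℝ × ℝ => Real.exp (-q * p.2) * hConv (f p.1) μ (g p.1) ν p.2)
      ((volume.restrict (Ioi 0)).prod (volume.restrict (Ioi 0))) := by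
  have hmeas : Measurable fun r : (ℝ × ℝ) × ℝ =>
      indicator {r : (ℝ × ℝ) × ℝ | 0 < r.2 ∧ r.2 ≤ r.1.2}
        (fun r => h (r.1.2 - r.2) (f r.1.1) μ * h r.2 (g r.1.1) ν) r := by
    refine Measurable.indicator ?_ ?_
    · exact ((measurable_h μ).comp (by fun_prop : Measurable fun r : (ℝ × ℝ) × ℝ =>
        (r.1.2 - r.2, f r.1.1))).mul ((measurable_h ν).comp (by fun_prop :
          Measurable fun r : (ℝ × ℝ) × ℝ => (r.2, g r.1.1)))
    · exact (measurableSet_lt measurable_const measurable_snd).inter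
        (measurableSet_le measurable_snd measurable_fst.snd)
  have hint := (hmeas.stronglyMeasurable.integral_prod_right' (ν := volume)).aestronglyMeasurable
    (μ := (volume.restrict (Ioi (0 : ℝ))).prod (volume.restrict (Ioi (0 : ℝ))))
  have hexp : AEStronglyMeasurable (fun p : ℝ × ℝ => Real.exp (-q * p.2))
      ((volume.restrict (Ioi (0 : ℝ))).prod (volume.restrict (Ioi (0 : ℝ)))) := by fun_prop
  refine (hexp.mul hint).congr ?_
  rw [Measure.prod_restrict]
  filter_upwards [ae_restrict_mem (measurableSet_Ioi.prod measurableSet_Ioi)] with p hp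
  simp only [Pi.mul_apply]
  rw [hConv, intervalIntegral.integral_of_le (le_of_lt hp.2), ← integral_indicator measurableSet_Ioc]
  rfl

theorem D_pos {β μp μm q : ℝ} (hβ : β ∈ Ioo (-1 : ℝ) 1) (hq : 0 < q) : 0 < D β μp μm q := by
  have hlt (μ : ℝ) : |μ| < Real.sqrt (2 * q + μ ^ 2) :=
    Real.lt_sqrt_of_sq_lt (by rw [sq_abs]; linarith)
  have hp := (neg_abs_le μp).trans_lt' (neg_lt_neg (hlt μp))
  have hm := (le_abs_self μm).trans_lt (hlt μm)
  exact add_pos (mul_pos (by linarith [hβ.1]) (by linarith))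
    (mul_pos (by linarith [hβ.2]) (by linarith))

/-- Laplace transform (in time) of the transition density of refracted skew Brownian
motion started at 0, for `y < 0`. -/
theorem laplace_transition_density_neg (β μp μm q y : ℝ)
    (hβ : β ∈ Ioo (-1 : ℝ) 1) (hq : 0 < q) (hy : y < 0) :
    ∫ t in Ioi (0 : ℝ), Real.exp (-q * t) *
        (2 * (1 - β) * Real.exp (2 * μm * y) *
          ∫ b in Ioi (0 : ℝ), ∫ τ in (0 : ℝ)..t,
            h (t - τ) ((1 + β) * b) μp * h τ ((1 - β) * b - y) (-μm))
      = 2 * (1 - β) / D β μp μm q * Real.exp ((μm + Real.sqrt (2 * q + μm ^ 2)) * y) := by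
  have hp : 0 < 1 + β := by linarith [hβ.1]
  have hm : 0 < 1 - β := by linarith [hβ.2]
  have hD := D_pos (μp := μp) (μm := μm) hβ hq
  set c := Real.exp ((-μm + Real.sqrt (2 * q + μm ^ 2)) * y) with hc
  have hx {b : ℝ} (hb : b ∈ Ioi (0 : ℝ)) : 0 < (1 + β) * b := mul_pos hp hb
  have hz {b : ℝ} (hb : b ∈ Ioi (0 : ℝ)) : 0 < (1 - β) * b - y := by
    linarith [mul_pos hm (mem_Ioi.1 hb)]
  have hinner {b : ℝ} (hb : b ∈ Ioi (0 : ℝ)) :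
      ∫ t in Ioi (0 : ℝ), Real.exp (-q * t) *
        hConv ((1 + β) * b) μp ((1 - β) * b - y) (-μm) t = c * Real.exp (-D β μp μm q * b) := by
    rw [(integrableOn_and_integral_exp_mul_hConv hq μp (-μm) (hx hb) (hz hb)).2, hc,
      ← Real.exp_add, ← Real.exp_add, neg_sq, D]
    congr 1
    ring
  have hint : Integrable (Function.uncurry fun b t => Real.exp (-q * t) *
      hConv ((1 + β) * b) μp ((1 - β) * b - y) (-μm) t)
      ((volume.restrict (Ioi 0)).prod (volume.restrict (Ioi 0))) := by
    have hmeas := aestronglyMeasurable_exp_mul_hConv q μp (-μm)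
      (f := fun b => (1 + β) * b) (g := fun b => (1 - β) * b - y) (by fun_prop) (by fun_prop)
    refine (integrable_prod_iff hmeas).2 ⟨?_, ?_⟩
    · filter_upwards [ae_restrict_mem measurableSet_Ioi] with b hb
      exact (integrableOn_and_integral_exp_mul_hConv hq μp (-μm) (hx hb) (hz hb)).1
    · refine ((integrableOn_exp_mul_Ioi (neg_neg_of_pos hD) 0).const_mul c).congr ?_
      filter_upwards [ae_restrict_mem measurableSet_Ioi] with b hb
      rw [← hinner hb]
      refine setIntegral_congr_fun measurableSet_Ioi fun t ht => ?_
      exact (Real.norm_of_nonneg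
        (mul_nonneg (Real.exp_nonneg _) (hConv_nonneg _ _ _ _ (le_of_lt ht)))).symm
  calc ∫ t in Ioi (0 : ℝ), Real.exp (-q * t) *
        (2 * (1 - β) * Real.exp (2 * μm * y) *
          ∫ b in Ioi (0 : ℝ), hConv ((1 + β) * b) μp ((1 - β) * b - y) (-μm) t)
      = 2 * (1 - β) * Real.exp (2 * μm * y) * ∫ t in Ioi (0 : ℝ), ∫ b in Ioi (0 : ℝ),
          Real.exp (-q * t) * hConv ((1 + β) * b) μp ((1 - β) * b - y) (-μm) t := by
        simp_rw [integral_const_mul, ← integral_const_mul, mul_left_comm (Real.exp (-q * _))]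
    _ = 2 * (1 - β) * Real.exp (2 * μm * y) *
          ∫ b in Ioi (0 : ℝ), c * Real.exp (-D β μp μm q * b) := by
        rw [← integral_integral_swap hint,
          setIntegral_congr_fun measurableSet_Ioi fun b hb => hinner hb]
    _ = 2 * (1 - β) / D β μp μm q * Real.exp ((μm + Real.sqrt (2 * q + μm ^ 2)) * y) := by
        rw [integral_const_mul, integral_exp_mul_Ioi (neg_neg_of_pos hD),
          show (μm + Real.sqrt (2 * q + μm ^ 2)) * y =
            2 * μm * y + (-μm + Real.sqrt (2 * q + μm ^ 2)) * y by ring, Real.exp_add, ← hc]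
        simp only [mul_zero, Real.exp_zero]
        field_simp
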